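/- Let V be an irreducible vector configuration of rank r in a finite-dimensional real vector space E with dim E ≥ 1, and suppose disc(V) ≤ 2. Then V admits a codegree* decomposition of length at least r − disc(V). -/

import Mathlib

open scoped Classical

noncomputable section

variable {E : Type*} [AddCommGroup E] [Module ℝ E] {ι : Type*} [Fintype ι]

/-- Number of indices where the functional is positive. -/
def posCount (φ : E →ₗ[ℝ] ℝ) (V : ι → E) : ℕ :=
  (Finset.univ.filter fun i => 0 < φ (V i)).card

/-- Number of indices where the functional is negative. -/
def negCount (φ : E →ₗ[ℝ] ℝ) (V : ι → E) : ℕ :=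
  (Finset.univ.filter fun i => φ (V i) < 0).card

/-- Number of indices where the functional is nonpositive. -/
def nonposCount (φ : E →ₗ[ℝ] ℝ) (V : ι → E) : ℕ :=
  (Finset.univ.filter fun i => φ (V i) ≤ 0).card

/-- Dual codegree: minimum over nonzero functionals of `nonposCount`; by convention the
number of elements when the ambient space is zero-dimensional (trivial). -/
def codegStar (V : ι → E) : ℕ :=
  if Nontrivial E then
    sInf {k | ∃ φ : E →ₗ[ℝ] ℝ, φ ≠ 0 ∧ nonposCount φ V = k}
  else Fintype.card ι

/-- Rank of a configuration: dimension of the linear span. -/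
def confRank (V : ι → E) : ℕ :=
  Module.finrank ℝ (Submodule.span ℝ (Set.range V))

/-- Dual degree: maximum over nonzero functionals of `posCount`, minus the rank. -/
def degStar (V : ι → E) : ℤ :=
  (sSup {k | ∃ φ : E →ₗ[ℝ] ℝ, φ ≠ 0 ∧ posCount φ V = k} : ℕ) - (confRank V : ℤ)

/-- Covector discrepancy: maximum over all functionals of `|φ⁺(V) − φ⁻(V)|`. -/
def disc (V : ι → E) : ℕ :=
  sSup {k | ∃ φ : E →ₗ[ℝ] ℝ, k = ((posCount φ V : ℤ) - (negCount φ V : ℤ)).natAbs}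

/-- The subfamily of `V` indexed by `S`. -/
def subfam (V : ι → E) (S : Finset ι) : {i // i ∈ S} → E := fun i => V i.1

/-- The contraction `V/W`, where `W = V|S`: images of the remaining vectors in the
quotient by the span of `W`. -/
def contract (V : ι → E) (S : Finset ι) :
    {i // i ∉ S} → E ⧸ Submodule.span ℝ (V '' (S : Set ι)) :=
  fun i => Submodule.Quotient.mk (V i.1)

/-- `V|S` is linearly closed in `V`. -/
def LinClosed (V : ι → E) (S : Finset ι) : Prop :=
  ∀ i, V i ∈ Submodule.span ℝ (V '' (S : Set ι)) → i ∈ S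

/-- A codegree* decomposition of `V` of length `m`: a partition of the index set into
parts `S 0, S 1, …, S m` with `codegStar (V|S i) ≥ 1` for `i ≠ 0` and
`codegStar V = ∑_{i=1}^m codegStar (V|S i)`. -/
def IsCodegDecomp (V : ι → E) (m : ℕ) (S : Fin (m + 1) → Finset ι) : Prop :=
  (∀ i j, i ≠ j → Disjoint (S i) (S j)) ∧
  (∀ x, ∃ i, x ∈ S i) ∧
  (∀ i, i ≠ 0 → 1 ≤ codegStar (subfam V (S i))) ∧
  codegStar V = ∑ i ∈ Finset.univ.erase (0 : Fin (m + 1)), codegStar (subfam V (S i))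

/-- Integer valued sign of a real number. -/
def sg (r : ℝ) : ℤ := ((SignType.sign r : SignType) : ℤ)

lemma sg_pos {r : ℝ} (h : 0 < r) : sg r = 1 := by simp [sg, sign_pos h]
lemma sg_neg' {r : ℝ} (h : r < 0) : sg r = -1 := by simp [sg, sign_neg h]
lemma sg_zero : sg 0 = 0 := by simp [sg]
lemma sg_neg (r : ℝ) : sg (-r) = - sg r := by
  rcases lt_trichotomy r 0 with h | h | h
  · rw [sg_neg' h, sg_pos (by linarith)]; rfl
  · subst h; simp [sg_zero]
  · rw [sg_pos h, sg_neg' (by linarith)]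
lemma sg_mul (a b : ℝ) : sg (a * b) = sg a * sg b := by
  simp [sg, sign_mul]
lemma sg_ne_zero {r : ℝ} (h : r ≠ 0) : sg r = 1 ∨ sg r = -1 := by
  rcases lt_or_gt_of_ne h with h | h
  · right; exact sg_neg' h
  · left; exact sg_pos h
lemma sg_eq_zero {r : ℝ} (h : sg r = 0) : r = 0 := by
  by_contra hr
  rcases sg_ne_zero hr with h' | h' <;> omega
lemma sg_int {k : ℤ} (h : |k| = 1) : sg (k : ℝ) = k := by
  rcases (abs_eq (by norm_num)).1 h with h | h
  · subst h; exact_mod_cast sg_pos one_pos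
  · subst h; rw [sg_neg' (by norm_num)]

/-- Weighted signed count. -/
def dd (X : Finset E) (W : E → ℤ) (φ : E →ₗ[ℝ] ℝ) : ℤ := ∑ u ∈ X, W u * sg (φ u)

/-- Reduced weighted configuration. -/
def Red (X : Finset E) (W : E → ℤ) : Prop :=
  (∀ u ∈ X, u ≠ 0 ∧ W u ≠ 0) ∧ ∀ u ∈ X, ∀ u' ∈ X, u' ∈ Submodule.span ℝ {u} → u' = u

lemma Red.mono {X Y : Finset E} {W : E → ℤ} (h : Red X W) (hY : Y ⊆ X) : Red Y W :=
  ⟨fun u hu => h.1 u (hY hu), fun u hu u' hu' => h.2 u (hY hu) u' (hY hu')⟩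

lemma dd_congr {X : Finset E} {W : E → ℤ} {φ ψ : E →ₗ[ℝ] ℝ}
    (h : ∀ u ∈ X, sg (φ u) = sg (ψ u)) : dd X W φ = dd X W ψ :=
  Finset.sum_congr rfl fun u hu => by rw [h u hu]

lemma dd_neg (X : Finset E) (W : E → ℤ) (φ : E →ₗ[ℝ] ℝ) : dd X W (-φ) = - dd X W φ := by
  simp [dd, sg_neg]

lemma lex (X : Finset E) (ψ χ : E →ₗ[ℝ] ℝ) :
    ∃ ε : ℝ, 0 < ε ∧ ∀ u ∈ X,
      sg ((ψ + ε • χ) u) = if ψ u = 0 then sg (χ u) else sg (ψ u) := by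
  have key : ∀ u ∈ X, ∀ᶠ ε in nhdsWithin (0 : ℝ) (Set.Ioi 0),
      sg ((ψ + ε • χ) u) = if ψ u = 0 then sg (χ u) else sg (ψ u) := by
    intro u _
    by_cases h0 : ψ u = 0
    · filter_upwards [self_mem_nhdsWithin] with ε hε
      simp [h0, sg_mul, sg_pos (show (0 : ℝ) < ε from hε)]
    · have hc : Filter.Tendsto (fun ε : ℝ => (ψ + ε • χ) u) (nhdsWithin 0 (Set.Ioi 0))
          (nhds (ψ u)) := by
        have : Continuous (fun ε : ℝ => (ψ + ε • χ) u) := by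
          simp only [LinearMap.add_apply, LinearMap.smul_apply, smul_eq_mul]; fun_prop
        have h2 := this.tendsto 0
        simp only [zero_smul, add_zero] at h2
        exact h2.mono_left nhdsWithin_le_nhds
      rw [if_neg h0]
      rcases lt_or_gt_of_ne h0 with h | h
      · filter_upwards [hc.eventually (gt_mem_nhds h)] with ε hε
        rw [sg_neg' hε, sg_neg' h]
      · filter_upwards [hc.eventually (lt_mem_nhds h)] with ε hε
        rw [sg_pos hε, sg_pos h]
  have := (Filter.eventually_all_finset X).2 key
  obtain ⟨ε, h1, h2⟩ := (this.and self_mem_nhdsWithin).exists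
  exact ⟨ε, h2, h1⟩

lemma dd_lex {X : Finset E} {W : E → ℤ} {ψ χ φ : E →ₗ[ℝ] ℝ}
    (h : ∀ u ∈ X, sg (φ u) = if ψ u = 0 then sg (χ u) else sg (ψ u)) :
    dd X W φ = dd X W ψ + dd (X.filter fun u => ψ u = 0) W χ := by
  unfold dd
  rw [Finset.sum_filter, ← Finset.sum_add_distrib]
  refine Finset.sum_congr rfl fun u hu => ?_
  rw [h u hu]
  split_ifs with h0
  · simp [h0, sg_zero]
  · simp

lemma pres {F : Submodule ℝ E} {u : E} (hu : u ∉ F) (c : ℝ) :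
    ∃ θ : E →ₗ[ℝ] ℝ, (∀ v ∈ F, θ v = 0) ∧ θ u = c := by
  obtain ⟨f, hf, hF⟩ := Submodule.exists_le_ker_of_notMem hu
  refine ⟨(c / f u) • f, fun v hv => ?_, ?_⟩
  · have : f v = 0 := hF hv
    simp [this]
  · simp; field_simp

lemma exact_fun (X : Finset E) (F : Submodule ℝ E) :
    ∃ ψ : E →ₗ[ℝ] ℝ, (∀ u ∈ F, ψ u = 0) ∧ ∀ u ∈ X, u ∉ F → ψ u ≠ 0 := by
  induction X using Finset.induction_on with
  | empty => exact ⟨0, by simp, by simp⟩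
  | insert a s ha ih =>
    obtain ⟨ψ, h1, h2⟩ := ih
    by_cases haF : a ∈ F
    · refine ⟨ψ, h1, fun u hu huF => ?_⟩
      rcases Finset.mem_insert.1 hu with rfl | hu
      · exact absurd haF huF
      · exact h2 u hu huF
    · obtain ⟨θ, t1, t2⟩ := pres haF 1
      obtain ⟨ε, -, hl⟩ := lex (insert a s) ψ θ
      refine ⟨ψ + ε • θ, fun u hu => by simp [h1 u hu, t1 u hu], fun u hu huF h0 => ?_⟩
      have := hl u hu
      rw [h0, sg_zero] at this
      split_ifs at this with hp
      · rcases Finset.mem_insert.1 hu with rfl | hu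
        · rw [t2, sg_pos one_pos] at this; omega
        · exact h2 u hu huF hp
      · exact hp (sg_eq_zero this.symm)

lemma filter_exact {X : Finset E} {F : Submodule ℝ E} {ψ : E →ₗ[ℝ] ℝ}
    (h1 : ∀ u ∈ F, ψ u = 0) (h2 : ∀ u ∈ X, u ∉ F → ψ u ≠ 0) :
    (X.filter fun u => ψ u = 0) = X.filter (· ∈ F) := by
  ext u
  simp only [Finset.mem_filter]
  constructor
  · rintro ⟨a, b⟩
    exact ⟨a, by_contra fun c => h2 u a c b⟩
  · rintro ⟨a, b⟩
    exact ⟨a, h1 u b⟩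

lemma wall {X : Finset E} {W : E → ℤ} (Y : Finset E) {x : E} (hx : x ∈ X) (hx0 : x ≠ 0)
    {ψ : E →ₗ[ℝ] ℝ} (hψ : ψ x = 0) (hn : ∀ u ∈ X, u ≠ x → ψ u ≠ 0) :
    ∃ φ₁ φ₂ : E →ₗ[ℝ] ℝ, dd X W φ₁ - dd X W φ₂ = 2 * W x ∧ sg (φ₁ x) = 1 ∧ sg (φ₂ x) = -1 ∧
      ∀ u ∈ Y, ψ u ≠ 0 → sg (φ₁ u) = sg (ψ u) ∧ sg (φ₂ u) = sg (ψ u) := by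
  obtain ⟨χ, -, hχ⟩ := pres (F := ⊥) (u := x) (by simpa using hx0) 1
  obtain ⟨ε₁, -, h1⟩ := lex (X ∪ Y) ψ χ
  obtain ⟨ε₂, -, h2⟩ := lex (X ∪ Y) ψ (-χ)
  have hf : (X.filter fun u => ψ u = 0) = {x} := by
    ext u
    simp only [Finset.mem_filter, Finset.mem_singleton]
    constructor
    · rintro ⟨a, b⟩
      exact by_contra fun c => hn u a c b
    · rintro rfl; exact ⟨hx, hψ⟩
  refine ⟨ψ + ε₁ • χ, ψ + ε₂ • (-χ), ?_, ?_, ?_, ?_⟩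
  · rw [dd_lex (fun u hu => h1 u (Finset.mem_union_left _ hu)),
      dd_lex (fun u hu => h2 u (Finset.mem_union_left _ hu)), hf, dd_neg]
    simp [dd, hχ, sg_pos one_pos]; ring
  · rw [h1 x (Finset.mem_union_left _ hx), if_pos hψ, hχ, sg_pos one_pos]
  · rw [h2 x (Finset.mem_union_left _ hx), if_pos hψ]; simp [hχ, sg_neg, sg_pos one_pos]
  · intro u hu h0
    rw [h1 u (Finset.mem_union_right _ hu), h2 u (Finset.mem_union_right _ hu), if_neg h0, if_neg h0]
    exact ⟨rfl, rfl⟩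

lemma nonvanish {X : Finset E} {W : E → ℤ} (h : Red X W) {x : E} (hx : x ∈ X) :
    ∃ χ : E →ₗ[ℝ] ℝ, dd X W χ ≠ 0 := by
  obtain ⟨ψ, h1, h2⟩ := exact_fun X (Submodule.span ℝ {x})
  obtain ⟨φ₁, φ₂, h3, -⟩ := wall (W := W) ∅ hx (h.1 x hx).1
    (h1 x (Submodule.mem_span_singleton_self x))
    (fun u hu hux => h2 u hu fun hm => hux (h.2 x hx u hu hm))
  by_contra! hc
  rw [hc, hc] at h3
  exact (h.1 x hx).2 (by omega)

lemma restrict_bound {X : Finset E} {W : E → ℤ} {D : ℤ} (hD : ∀ φ, |dd X W φ| ≤ D)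
    (F : Submodule ℝ E) (φ : E →ₗ[ℝ] ℝ) : |dd (X.filter (· ∈ F)) W φ| ≤ D := by
  obtain ⟨ψ, h1, h2⟩ := exact_fun X F
  obtain ⟨ε₁, -, l1⟩ := lex X ψ φ
  obtain ⟨ε₂, -, l2⟩ := lex X (-ψ) φ
  have e1 := dd_lex (W := W) l1
  have e2 := dd_lex (W := W) l2
  have b1 := hD (ψ + ε₁ • φ)
  have b2 := hD (-ψ + ε₂ • φ)
  simp only [LinearMap.neg_apply, neg_eq_zero] at e2
  rw [e1, filter_exact h1 h2] at b1
  rw [e2, filter_exact h1 h2, dd_neg] at b2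
  rw [abs_le] at *
  omega

lemma lex_bound {X : Finset E} {W : E → ℤ} {D : ℤ} (hD : ∀ φ, |dd X W φ| ≤ D)
    (ψ χ : E →ₗ[ℝ] ℝ) : |dd X W ψ| + |dd (X.filter fun u => ψ u = 0) W χ| ≤ D := by
  obtain ⟨ε₁, -, l1⟩ := lex X ψ χ
  obtain ⟨ε₂, -, l2⟩ := lex X ψ (-χ)
  have b1 := hD (ψ + ε₁ • χ)
  have b2 := hD (ψ + ε₂ • (-χ))
  rw [dd_lex l1] at b1
  rw [dd_lex l2, dd_neg] at b2
  rw [abs_le] at *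
  rcases abs_cases (dd X W ψ) with h | h <;>
  rcases abs_cases (dd (X.filter fun u => ψ u = 0) W χ) with h' | h' <;> omega

lemma filter_span_self {X : Finset E} {W : E → ℤ} (h : Red X W) {x : E} (hx : x ∈ X) :
    X.filter (· ∈ Submodule.span ℝ {x}) = {x} := by
  ext u
  simp only [Finset.mem_filter, Finset.mem_singleton]
  constructor
  · rintro ⟨a, b⟩; exact h.2 x hx u a b
  · rintro rfl; exact ⟨hx, Submodule.mem_span_singleton_self _⟩

lemma weight_bound {X : Finset E} {W : E → ℤ} {D : ℤ} (h : Red X W) (hD : ∀ φ, |dd X W φ| ≤ D)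
    {x : E} (hx : x ∈ X) : |W x| ≤ D := by
  obtain ⟨χ, -, hχ⟩ := pres (F := ⊥) (u := x) (by simpa using (h.1 x hx).1) 1
  have := restrict_bound hD (Submodule.span ℝ {x}) χ
  rw [filter_span_self h hx] at this
  simpa [dd, hχ, sg_pos one_pos] using this

lemma line_lemma {X : Finset E} {W : E → ℤ} (h : Red X W) {x z : E} (hx : x ∈ X)
    (hz : z ∈ X) (hzx : z ∉ Submodule.span ℝ {x})
    (hL : ∀ φ, |dd (X.filter (· ∈ Submodule.span ℝ {x, z})) W φ| ≤ 1) :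
    ∃ φ : E →ₗ[ℝ] ℝ, φ x = -(W x : ℝ) ∧
      dd (X.filter (· ∈ Submodule.span ℝ {x, z})) W φ = 1 ∧
      ∀ u ∈ X.filter (· ∈ Submodule.span ℝ {x, z}), φ u ≠ 0 := by
  set XL := X.filter (· ∈ Submodule.span ℝ {x, z}) with hXL
  have hWx0 : (W x : ℝ) ≠ 0 := by exact_mod_cast (h.1 x hx).2
  have hxz : x ∉ Submodule.span ℝ {z} := fun hm => by
    have := h.2 z hz x hx hm
    subst this; exact hzx (Submodule.mem_span_singleton_self _)
  obtain ⟨ψ, p1, p2⟩ := pres hxz (-(W x : ℝ))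
  have pz : ψ z = 0 := p1 z (Submodule.mem_span_singleton_self _)
  have hzL : z ∈ XL := by
    simp only [hXL, Finset.mem_filter]
    exact ⟨hz, Submodule.subset_span (by simp)⟩
  have hxL : x ∈ XL := by
    simp only [hXL, Finset.mem_filter]
    exact ⟨hx, Submodule.subset_span (by simp)⟩
  have hn : ∀ u ∈ XL, u ≠ z → ψ u ≠ 0 := by
    intro u hu huz h0
    rw [hXL, Finset.mem_filter, Submodule.mem_span_pair] at hu
    obtain ⟨huX, a, b, rfl⟩ := hu
    simp [pz, p2, (h.1 x hx).2] at h0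
    subst h0
    exact huz (h.2 z hz _ huX (by simpa using Submodule.smul_mem _ b (Submodule.mem_span_singleton_self z)))
  obtain ⟨φ₁, φ₂, w1, w2, w3, w4⟩ := wall (W := W) XL hzL (h.1 z hz).1 pz hn
  have hxz' : x ≠ z := by rintro rfl; exact hzx (Submodule.mem_span_singleton_self _)
  have main : ∀ φ : E →ₗ[ℝ] ℝ, sg (φ z) ≠ 0 → (∀ u ∈ XL, ψ u ≠ 0 → sg (φ u) = sg (ψ u)) →
      dd XL W φ = 1 → ∃ φ : E →ₗ[ℝ] ℝ, φ x = -(W x : ℝ) ∧ dd XL W φ = 1 ∧ ∀ u ∈ XL, φ u ≠ 0 := by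
    intro φ s1 s2 s3
    have hφn : ∀ u ∈ XL, φ u ≠ 0 := by
      intro u hu h0
      by_cases huz : u = z
      · subst huz; exact s1 (by rw [h0, sg_zero])
      · have := s2 u hu (hn u hu huz)
        rw [h0, sg_zero] at this
        exact hn u hu huz (sg_eq_zero this.symm)
    have hsx := s2 x hxL (hn x hxL hxz')
    have hc : 0 < ψ x / φ x := by
      have h1 := hφn x hxL
      have h2 := hn x hxL hxz'
      rcases lt_or_gt_of_ne h1 with a | a <;> rcases lt_or_gt_of_ne h2 with b | b
      · exact div_pos_of_neg_of_neg b a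
      · rw [sg_neg' a, sg_pos b] at hsx; omega
      · rw [sg_pos a, sg_neg' b] at hsx; omega
      · exact div_pos b a
    refine ⟨(ψ x / φ x) • φ, ?_, ?_, ?_⟩
    · have h1 := hφn x hxL
      simp only [LinearMap.smul_apply, smul_eq_mul]
      rw [← p2]; field_simp
    · rw [← s3]
      apply dd_congr
      intro u _
      simp [sg_mul, sg_pos hc]
    · intro u hu
      simp only [LinearMap.smul_apply, smul_eq_mul]
      exact mul_ne_zero hc.ne' (hφn u hu)
  have b1 := abs_le.1 (hL φ₁)
  have b2 := abs_le.1 (hL φ₂)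
  have hWz := (h.1 z hz).2
  by_cases hd : dd XL W φ₁ = 1
  · exact main φ₁ (by omega) (fun u hu h0 => (w4 u hu h0).1) hd
  · refine main φ₂ (by omega) (fun u hu h0 => (w4 u hu h0).2) (by omega)

lemma sum_lines {X : Finset E} {W : E → ℤ} (h : Red X W) {x : E} (hx : x ∈ X)
    (H : Submodule ℝ E) (hxH : x ∈ H) (φ : E →ₗ[ℝ] ℝ) (hφ : W x * sg (φ x) = -1)
    (hL : ∀ z ∈ X, z ∉ H → -1 ≤ dd (X.filter (· ∈ Submodule.span ℝ {x, z})) W φ)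
    {z₁ z₂ : E} (hz₁ : z₁ ∈ X) (hz₂ : z₂ ∈ X) (hz₁H : z₁ ∉ H) (hz₂H : z₂ ∉ H)
    (hne : Submodule.span ℝ {x, z₁} ≠ Submodule.span ℝ {x, z₂})
    (h1 : dd (X.filter (· ∈ Submodule.span ℝ {x, z₁})) W φ = 1)
    (h2 : dd (X.filter (· ∈ Submodule.span ℝ {x, z₂})) W φ = 1) :
    dd (X.filter (· ∈ H)) W φ + 4 ≤ dd X W φ := by
  have split : dd X W φ = dd (X.filter (· ∈ H)) W φ + dd (X.filter (· ∉ H)) W φ :=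
    (Finset.sum_filter_add_sum_filter_not X (· ∈ H) _).symm
  rw [split]
  set Z := X.filter (· ∉ H) with hZ
  let key : E → Submodule ℝ E := fun z => Submodule.span ℝ {x, z}
  have fib : dd Z W φ = ∑ K ∈ Z.image key, ∑ u ∈ Z.filter (fun u => key u = K), W u * sg (φ u) :=
    (Finset.sum_fiberwise_of_maps_to (fun u hu => Finset.mem_image_of_mem key hu) _).symm
  have fibK : ∀ z ∈ Z, ∑ u ∈ Z.filter (fun u => key u = key z), W u * sg (φ u)
      = dd (X.filter (· ∈ key z)) W φ + 1 := by
    intro z hz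
    rw [hZ, Finset.mem_filter] at hz
    have hins : X.filter (· ∈ key z) = insert x (Z.filter (fun u => key u = key z)) := by
      ext u
      simp only [Finset.mem_filter, Finset.mem_insert, hZ]
      constructor
      · rintro ⟨a, b⟩
        by_cases hux : u = x
        · exact Or.inl hux
        right
        obtain ⟨p, q, rfl⟩ := Submodule.mem_span_pair.1 b
        have hq : q ≠ 0 := by
          rintro rfl
          refine hux (h.2 x hx _ a ?_)
          simpa using Submodule.smul_mem _ p (Submodule.mem_span_singleton_self x)
        have hzz : ∀ K : Submodule ℝ E, x ∈ K → p • x + q • z ∈ K → z ∈ K := by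
          intro K k1 k2
          have := K.smul_mem q⁻¹ (K.sub_mem k2 (K.smul_mem p k1))
          simpa [smul_smul, hq] using this
        refine ⟨⟨a, fun hH => hz.2 (hzz H hxH hH)⟩, ?_⟩
        apply le_antisymm
        · refine Submodule.span_le.2 ?_
          rintro v (rfl | rfl)
          · exact Submodule.subset_span (by simp)
          · exact b
        · refine Submodule.span_le.2 ?_
          rintro v (rfl | rfl)
          · exact Submodule.subset_span (by simp)
          · exact hzz _ (Submodule.subset_span (by simp)) (Submodule.subset_span (by simp))
      · rintro (rfl | ⟨⟨a, b⟩, c⟩)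
        · exact ⟨hx, Submodule.subset_span (by simp)⟩
        · exact ⟨a, c ▸ Submodule.subset_span (by simp)⟩
    unfold dd
    rw [hins, Finset.sum_insert (by simp [hZ, hxH]), hφ]
    ring
  rw [fib]
  have m1 : z₁ ∈ Z := by simp [hZ, hz₁, hz₁H]
  have m2 : z₂ ∈ Z := by simp [hZ, hz₂, hz₂H]
  have nn : ∀ K ∈ Z.image key, 0 ≤ ∑ u ∈ Z.filter (fun u => key u = K), W u * sg (φ u) := by
    intro K hK
    obtain ⟨z, hz, rfl⟩ := Finset.mem_image.1 hK
    rw [fibK z hz]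
    rw [hZ, Finset.mem_filter] at hz
    have := hL z hz.1 hz.2
    change -1 ≤ dd (X.filter (· ∈ key z)) W φ at this
    omega
  have sub : ({key z₁, key z₂} : Finset _) ⊆ Z.image key := by
    intro K hK
    simp only [Finset.mem_insert, Finset.mem_singleton] at hK
    rcases hK with rfl | rfl
    · exact Finset.mem_image_of_mem key m1
    · exact Finset.mem_image_of_mem key m2
  have := Finset.sum_le_sum_of_subset_of_nonneg sub (fun K hK _ => nn K hK)
  rw [Finset.sum_pair hne, fibK z₁ m1, fibK z₂ m2] at this
  change dd (X.filter (· ∈ key z₁)) W φ = 1 at h1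
  change dd (X.filter (· ∈ key z₂)) W φ = 1 at h2
  rw [h1, h2] at this
  omega

lemma span_pair_le {x z : E} {K : Submodule ℝ E} (hx : x ∈ K) (hz : z ∈ K) :
    Submodule.span ℝ {x, z} ≤ K := by
  refine Submodule.span_le.2 ?_
  rintro v (rfl | rfl)
  · exact hx
  · exact hz

lemma eq_on_pair {x z : E} {φ ψ : E →ₗ[ℝ] ℝ} (hx : φ x = ψ x) (hz : φ z = ψ z) :
    ∀ u ∈ Submodule.span ℝ {x, z}, φ u = ψ u := by
  intro u hu
  obtain ⟨a, b, rfl⟩ := Submodule.mem_span_pair.1 hu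
  simp [hx, hz]

lemma cross {X : Finset E} {W : E → ℤ} (h : Red X W) {x z₁ z₂ : E} (hx : x ∈ X)
    (hz₁ : z₁ ∈ X) (hz₂ : z₂ ∈ X) (h1x : z₁ ∉ Submodule.span ℝ {x})
    (h2x : z₂ ∉ Submodule.span ℝ {x, z₁})
    (hL₁ : ∀ φ, |dd (X.filter (· ∈ Submodule.span ℝ {x, z₁})) W φ| ≤ 1)
    (hL₂ : ∀ φ, |dd (X.filter (· ∈ Submodule.span ℝ {x, z₂})) W φ| ≤ 1) :
    ∃ φ : E →ₗ[ℝ] ℝ, φ x = -(W x : ℝ) ∧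
      dd (X.filter (· ∈ Submodule.span ℝ {x, z₁})) W φ = 1 ∧
      dd (X.filter (· ∈ Submodule.span ℝ {x, z₂})) W φ = 1 ∧
      (∀ u ∈ X.filter (· ∈ Submodule.span ℝ {x, z₁}), φ u ≠ 0) ∧
      (∀ u ∈ X.filter (· ∈ Submodule.span ℝ {x, z₂}), φ u ≠ 0) := by
  have h2x' : z₂ ∉ Submodule.span ℝ {x} := fun hm =>
    h2x (Submodule.span_mono (by simp) hm)
  obtain ⟨φ₁, a1, a2, a3⟩ := line_lemma h hx hz₁ h1x hL₁
  obtain ⟨φ₂, b1, b2, b3⟩ := line_lemma h hx hz₂ h2x' hL₂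
  obtain ⟨θ, t1, t2⟩ := pres h2x (φ₂ z₂ - φ₁ z₂)
  have e1 : ∀ u ∈ Submodule.span ℝ {x, z₁}, (φ₁ + θ) u = φ₁ u := fun u hu => by
    simp [t1 u hu]
  have e2 : ∀ u ∈ Submodule.span ℝ {x, z₂}, (φ₁ + θ) u = φ₂ u := by
    apply eq_on_pair
    · rw [e1 x (Submodule.subset_span (by simp)), a1, b1]
    · simp [t2]
  refine ⟨φ₁ + θ, ?_, ?_, ?_, ?_, ?_⟩
  · rw [e1 x (Submodule.subset_span (by simp)), a1]
  · rw [← a2]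
    exact dd_congr fun u hu => by rw [e1 u (Finset.mem_filter.1 hu).2]
  · rw [← b2]
    exact dd_congr fun u hu => by rw [e2 u (Finset.mem_filter.1 hu).2]
  · intro u hu
    rw [e1 u (Finset.mem_filter.1 hu).2]; exact a3 u hu
  · intro u hu
    rw [e2 u (Finset.mem_filter.1 hu).2]; exact b3 u hu

lemma sg_W {W : E → ℤ} {x : E} {φ : E →ₗ[ℝ] ℝ} (hWx : |W x| = 1) (h : φ x = -(W x : ℝ)) :
    W x * sg (φ x) = -1 := by
  rw [h, sg_neg, sg_int hWx]
  rcases (abs_eq (by norm_num)).1 hWx with h | h <;> rw [h] <;> norm_num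

lemma finrank_span_pair_le (x z : E) : Module.finrank ℝ (Submodule.span ℝ {x, z}) ≤ 2 := by
  have := finrank_span_finset_le_card (R := ℝ) ({x, z} : Finset E)
  simp only [Finset.coe_insert, Finset.coe_singleton] at this
  exact this.trans Finset.card_le_two

/-- Discrepancy one forces rank at most two. -/
lemma disc_one [FiniteDimensional ℝ E] {X : Finset E} {W : E → ℤ} (h : Red X W)
    (hD : ∀ φ, |dd X W φ| ≤ 1) :
    Module.finrank ℝ (Submodule.span ℝ (X : Set E)) ≤ 2 := by
  suffices hs : ∃ x z : E, (X : Set E) ⊆ Submodule.span ℝ {x, z} by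
    obtain ⟨x, z, hs⟩ := hs
    exact (Submodule.finrank_mono (Submodule.span_le.2 hs)).trans (finrank_span_pair_le x z)
  rcases X.eq_empty_or_nonempty with rfl | ⟨x, hx⟩
  · exact ⟨0, 0, by simp⟩
  have hWx : |W x| = 1 := by
    have h1 := weight_bound h hD hx
    have h2 := abs_pos.2 (h.1 x hx).2
    omega
  by_cases hz : ∃ z ∈ X, z ∉ Submodule.span ℝ {x}
  swap
  · push Not at hz
    exact ⟨x, x, fun u hu => by simpa using hz u hu⟩
  obtain ⟨z, hz, hzx⟩ := hz
  refine ⟨x, z, fun u hu => ?_⟩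
  by_contra hc
  obtain ⟨φ, p1, p2, p3, -⟩ := cross h hx hz hu hzx hc
    (fun φ => restrict_bound hD _ φ) (fun φ => restrict_bound hD _ φ)
  have hux : u ∉ Submodule.span ℝ {x} := fun hm => hc (Submodule.span_mono (by simp) hm)
  have := sum_lines h hx (Submodule.span ℝ {x}) (Submodule.mem_span_singleton_self x) φ
    (sg_W hWx p1) (fun z _ _ => (abs_le.1 (restrict_bound hD _ φ)).1) hz hu hzx hux
    (fun he => hc (by
      show u ∈ Submodule.span ℝ {x, z}
      rw [he]; exact Submodule.subset_span (by simp))) p2 p3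
  rw [filter_span_self h hx] at this
  have h3 : dd {x} W φ = -1 := by simpa [dd] using sg_W hWx p1
  have := (abs_le.1 (hD φ)).2
  omega

lemma reduce (n : ℕ) : ∀ (X : Finset E) (W : E → ℤ), X.card = n →
    ∃ (X' : Finset E) (W' : E → ℤ), Red X' W' ∧ ∀ φ, dd X' W' φ = dd X W φ := by
  induction n using Nat.strong_induction_on with
  | _ n ih =>
  intro X W hn
  by_cases h1 : ∃ u ∈ X, u = 0 ∨ W u = 0
  · obtain ⟨u, hu, h0⟩ := h1
    obtain ⟨X', W', hr, hd⟩ := ih _ (by rw [← hn]; exact Finset.card_erase_lt_of_mem hu) (X.erase u) W rfl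
    refine ⟨X', W', hr, fun φ => ?_⟩
    rw [hd]
    unfold dd
    rw [← Finset.add_sum_erase X _ hu]
    rcases h0 with h0 | h0
    · simp [h0, sg_zero]
    · simp [h0]
  by_cases h2 : ∃ u ∈ X, ∃ u' ∈ X, u' ∈ Submodule.span ℝ {u} ∧ u' ≠ u
  · obtain ⟨u, hu, u', hu', hm, hne⟩ := h2
    obtain ⟨c, hc⟩ := Submodule.mem_span_singleton.1 hm
    obtain ⟨X', W', hr, hd⟩ := ih _ (by rw [← hn]; exact Finset.card_erase_lt_of_mem hu')
      (X.erase u') (Function.update W u (W u + sg c * W u')) rfl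
    refine ⟨X', W', hr, fun φ => ?_⟩
    rw [hd]
    unfold dd
    have hue : u ∈ X.erase u' := Finset.mem_erase.2 ⟨hne.symm, hu⟩
    rw [← Finset.add_sum_erase X _ hu', ← Finset.add_sum_erase _ _ hue,
      ← Finset.add_sum_erase _ (fun u => W u * sg (φ u)) hue]
    have : ∑ x ∈ (X.erase u').erase u, Function.update W u (W u + sg c * W u') x * sg (φ x)
        = ∑ x ∈ (X.erase u').erase u, W x * sg (φ x) := by
      refine Finset.sum_congr rfl fun y hy => ?_
      rw [Function.update_of_ne (Finset.ne_of_mem_erase hy)]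
    rw [this, Function.update_self, ← hc]
    simp only [map_smul, smul_eq_mul, sg_mul]
    ring
  · push Not at h1 h2
    exact ⟨X, W, ⟨h1, h2⟩, fun _ => rfl⟩

lemma reduce_family {κ : Type*} (S : Finset κ) (v : κ → E) (w : κ → ℤ) :
    ∃ (X : Finset E) (W : E → ℤ), Red X W ∧
      ∀ φ : E →ₗ[ℝ] ℝ, dd X W φ = ∑ i ∈ S, w i * sg (φ (v i)) := by
  obtain ⟨X, W, hr, hd⟩ := reduce _ (S.image v) (fun u => ∑ i ∈ S.filter (fun i => v i = u), w i) rfl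
  refine ⟨X, W, hr, fun φ => ?_⟩
  rw [hd, ← Finset.sum_fiberwise_of_maps_to (fun i hi => Finset.mem_image_of_mem v hi)]
  unfold dd
  refine Finset.sum_congr rfl fun u _ => ?_
  rw [Finset.sum_mul]
  refine Finset.sum_congr rfl fun i hi => ?_
  rw [(Finset.mem_filter.1 hi).2]

lemma parity {X : Finset E} {W : E → ℤ} {φ : E →ₗ[ℝ] ℝ} (h : ∀ u ∈ X, φ u ≠ 0) :
    (2 : ℤ) ∣ dd X W φ - ∑ u ∈ X, W u := by
  unfold dd
  rw [← Finset.sum_sub_distrib]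
  refine Finset.dvd_sum fun u hu => ?_
  rcases sg_ne_zero (h u hu) with h | h <;> rw [h]
  · simp
  · exact ⟨-W u, by ring⟩

lemma odd_bound {X : Finset E} {W : E → ℤ} (h : Red X W) (hD : ∀ φ, |dd X W φ| ≤ 2)
    (hodd : ¬ (2 : ℤ) ∣ ∑ u ∈ X, W u) (φ : E →ₗ[ℝ] ℝ) : |dd X W φ| ≤ 1 := by
  obtain ⟨χ, -, hχ⟩ := exact_fun X ⊥
  have hχ' : ∀ u ∈ X, χ u ≠ 0 := fun u hu => hχ u hu (by simpa using (h.1 u hu).1)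
  obtain ⟨ε₁, -, l1⟩ := lex X φ χ
  obtain ⟨ε₂, -, l2⟩ := lex X φ (-χ)
  have e1 := dd_lex (W := W) l1
  have e2 := dd_lex (W := W) l2
  rw [dd_neg] at e2
  have p1 := parity (W := W) (X := X) (φ := φ + ε₁ • χ) (fun u hu h0 => by
    have := l1 u hu
    rw [h0, sg_zero] at this
    split_ifs at this with hp
    · exact hχ' u hu (sg_eq_zero this.symm)
    · exact hp (sg_eq_zero this.symm))
  have p2 := parity (W := W) (X := X) (φ := φ + ε₂ • (-χ)) (fun u hu h0 => by
    have := l2 u hu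
    rw [h0, sg_zero] at this
    split_ifs at this with hp
    · have := sg_eq_zero this.symm
      simp only [LinearMap.neg_apply, neg_eq_zero] at this
      exact hχ' u hu this
    · exact hp (sg_eq_zero this.symm))
  have b1 := abs_le.1 (hD (φ + ε₁ • χ))
  have b2 := abs_le.1 (hD (φ + ε₂ • (-χ)))
  rw [abs_le]
  omega

lemma exists_H [FiniteDimensional ℝ E] {X : Finset E} {W : E → ℤ} (h : Red X W)
    (hD : ∀ φ, |dd X W φ| ≤ 2) {x : E} (hx : x ∈ X) :
    ∃ H : Submodule ℝ E, Module.finrank ℝ H ≤ 3 ∧ x ∈ H ∧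
      ∀ F : Submodule ℝ E, x ∈ F →
        (2 : ℤ) ∣ ∑ u ∈ X.filter (· ∈ F), W u - ∑ u ∈ (X.filter (· ∈ F)).filter (· ∈ H), W u := by
  obtain ⟨f, -, hf⟩ := pres (F := ⊥) (u := x) (by simpa using (h.1 x hx).1) 1
  let π : E →ₗ[ℝ] E := LinearMap.id - f.smulRight x
  have hπ : ∀ u, π u = u - f u • x := fun u => by simp [π]
  obtain ⟨X', W', hr, hd⟩ := reduce_family X π W
  have hd' : ∀ φ : E →ₗ[ℝ] ℝ, dd X' W' φ = dd X W (φ ∘ₗ π) := fun φ => by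
    rw [hd]; rfl
  have hb : ∀ φ, |dd X' W' φ| ≤ 1 := by
    intro φ
    rw [hd']
    have hx0 : (φ ∘ₗ π) x = 0 := by simp [hπ, hf]
    obtain ⟨χ, hχ⟩ := nonvanish (h.mono (Finset.filter_subset (fun u => (φ ∘ₗ π) u = 0) X))
      (Finset.mem_filter.2 ⟨hx, hx0⟩)
    have h1 := lex_bound hD (φ ∘ₗ π) χ
    have h2 := abs_pos.2 hχ
    omega
  have hrk := disc_one hr hb
  have hd0 : ∀ φ : E →ₗ[ℝ] ℝ, φ x = 0 → dd X W φ = dd X' W' φ := by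
    intro φ h0
    rw [hd']
    exact dd_congr fun u _ => by simp [hπ, h0]
  set H := Submodule.span ℝ (X' : Set E) ⊔ Submodule.span ℝ {x} with hH
  have hxH : x ∈ H := Submodule.mem_sup_right (Submodule.mem_span_singleton_self x)
  refine ⟨H, ?_, hxH, ?_⟩
  · have h1 := Submodule.finrank_add_le_finrank_add_finrank (Submodule.span ℝ (X' : Set E))
      (Submodule.span ℝ {x})
    have h2 := finrank_span_singleton (K := ℝ) (h.1 x hx).1
    rw [← hH] at h1
    omega
  intro F hxF
  obtain ⟨ψ, p1, p2⟩ := exact_fun X F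
  obtain ⟨χ, q1, q2⟩ := exact_fun X H
  obtain ⟨ε, -, l1⟩ := lex X ψ χ
  have e1 := dd_lex (W := W) l1
  have e0 : dd X W (ψ + ε • χ) = dd X W ψ := by
    rw [hd0 _ (by simp [p1 x hxF, q1 x hxH]), hd0 _ (p1 x hxF)]
    refine dd_congr fun u hu => ?_
    have : χ u = 0 := q1 u (Submodule.mem_sup_left (Submodule.subset_span hu))
    simp [this]
  rw [e0, filter_exact p1 p2] at e1
  have e2 : dd (X.filter (· ∈ F)) W χ = 0 := by omega
  have e3 : dd (X.filter (· ∈ F)) W χ = dd ((X.filter (· ∈ F)).filter (· ∉ H)) W χ := by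
    unfold dd
    rw [← Finset.sum_filter_add_sum_filter_not (X.filter (· ∈ F)) (· ∈ H)]
    rw [Finset.sum_eq_zero, zero_add]
    intro u hu
    rw [q1 u (Finset.mem_filter.1 hu).2, sg_zero, mul_zero]
  have e4 := parity (W := W) (X := (X.filter (· ∈ F)).filter (· ∉ H)) (φ := χ) (fun u hu => by
    simp only [Finset.mem_filter] at hu
    exact q2 u hu.1.1 hu.2)
  have e5 := Finset.sum_filter_add_sum_filter_not (X.filter (· ∈ F)) (· ∈ H) W
  omega

lemma even_flat [FiniteDimensional ℝ E] {X : Finset E} {W : E → ℤ} (h : Red X W)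
    (hD : ∀ φ, |dd X W φ| ≤ 2) {x a b : E} (hx : x ∈ X) (ha : a ∈ X) (hb : b ∈ X)
    (hax : a ∉ Submodule.span ℝ {x}) (hbx : b ∉ Submodule.span ℝ {x, a})
    {F : Submodule ℝ E} (hxF : x ∈ F) (haF : a ∈ F) (hbF : b ∈ F) :
    (2 : ℤ) ∣ ∑ u ∈ X.filter (· ∈ F), W u := by
  by_contra hodd
  have hr := h.mono (Finset.filter_subset (· ∈ F) X)
  have h1 := disc_one hr (odd_bound hr (fun φ => restrict_bound hD F φ) hodd)
  set T := Submodule.span ℝ ((X.filter (· ∈ F) : Finset E) : Set E)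
  have xT : x ∈ T := Submodule.subset_span (by simp [hx, hxF])
  have aT : a ∈ T := Submodule.subset_span (by simp [ha, haF])
  have bT : b ∈ T := Submodule.subset_span (by simp [hb, hbF])
  have l1 : Submodule.span ℝ {x} < Submodule.span ℝ {x, a} :=
    SetLike.lt_iff_le_and_exists.2 ⟨Submodule.span_mono (by simp), a,
      Submodule.subset_span (by simp), hax⟩
  have l2 : Submodule.span ℝ {x, a} < T :=
    SetLike.lt_iff_le_and_exists.2 ⟨span_pair_le xT aT, b, bT, hbx⟩
  have f0 := finrank_span_singleton (K := ℝ) (h.1 x hx).1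
  have f1 := Submodule.finrank_lt_finrank_of_lt l1
  have f2 := Submodule.finrank_lt_finrank_of_lt l2
  omega

lemma mem_of_smul_add {K : Submodule ℝ E} {u z : E} {q : ℝ} (hq : q ≠ 0) (hu : u ∈ K)
    (h : u + q • z ∈ K) : z ∈ K := by
  have := K.smul_mem q⁻¹ (K.sub_mem h hu)
  simpa [smul_smul, hq] using this

lemma package [FiniteDimensional ℝ E] {X : Finset E} {W : E → ℤ} (h : Red X W)
    (hD : ∀ φ, |dd X W φ| ≤ 2) (hrk : 4 ≤ Module.finrank ℝ (Submodule.span ℝ (X : Set E)))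
    {x : E} (hx : x ∈ X) (hodd : ¬ (2 : ℤ) ∣ W x) :
    ∃ H : Submodule ℝ E, Module.finrank ℝ H ≤ 3 ∧ x ∈ H ∧ (∃ z ∈ X, z ∉ H) ∧
      (∀ z ∈ X, z ∉ H → ∀ u ∈ X, u ∉ H → u ∈ Submodule.span ℝ {x, z}) ∧
      (∀ z ∈ X, z ≠ x →
        (z ∉ H ↔ ¬ (2 : ℤ) ∣ ∑ u ∈ X.filter (· ∈ Submodule.span ℝ {x, z}), W u)) := by
  obtain ⟨H, hH3, hxH, hP⟩ := exists_H h hD hx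
  have hWx : |W x| = 1 := by
    have h1 := weight_bound h hD hx
    rcases abs_cases (W x) with h2 | h2 <;> omega
  have hspx : ∀ u ∈ X, u ≠ x → u ∉ Submodule.span ℝ {x} := fun u hu hux hm =>
    hux (h.2 x hx u hu hm)
  have hxx : ∀ z : E, x ∈ Submodule.span ℝ {x, z} := fun z => Submodule.subset_span (by simp)
  have hzz : ∀ z : E, z ∈ Submodule.span ℝ {x, z} := fun z => Submodule.subset_span (by simp)
  -- lines outside `H` are odd
  have hLodd : ∀ z ∈ X, z ∉ H →
      ¬ (2 : ℤ) ∣ ∑ u ∈ X.filter (· ∈ Submodule.span ℝ {x, z}), W u := by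
    intro z hz hzH hdv
    have h1 := hP (Submodule.span ℝ {x, z}) (hxx z)
    have h2 : (X.filter (· ∈ Submodule.span ℝ {x, z})).filter (· ∈ H) = {x} := by
      ext u
      simp only [Finset.mem_filter, Finset.mem_singleton]
      constructor
      · rintro ⟨⟨a, b⟩, c⟩
        obtain ⟨p, q, rfl⟩ := Submodule.mem_span_pair.1 b
        by_cases hq : q = 0
        · subst hq
          refine h.2 x hx _ a ?_
          simpa using Submodule.smul_mem _ p (Submodule.mem_span_singleton_self x)
        · exact absurd (mem_of_smul_add hq (H.smul_mem p hxH) c) hzH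
      · rintro rfl; exact ⟨⟨hx, hxx z⟩, hxH⟩
    rw [h2, Finset.sum_singleton] at h1
    omega
  have hL : ∀ z ∈ X, z ∉ H → ∀ φ,
      |dd (X.filter (· ∈ Submodule.span ℝ {x, z})) W φ| ≤ 1 := fun z hz hzH φ =>
    odd_bound (h.mono (Finset.filter_subset _ X)) (fun φ => restrict_bound hD _ φ)
      (hLodd z hz hzH) φ
  have hnotle : ∀ G : Submodule ℝ E, Module.finrank ℝ G ≤ 3 → ∃ z ∈ X, z ∉ G := by
    intro G hG
    by_contra! hc
    have := Submodule.finrank_mono (Submodule.span_le.2 (show (X : Set E) ⊆ G from hc))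
    omega
  obtain ⟨z₀, hz₀, hz₀H⟩ := hnotle H hH3
  refine ⟨H, hH3, hxH, ⟨z₀, hz₀, hz₀H⟩, ?_, ?_⟩
  · intro z₁ hz₁ hz₁H z₂ hz₂ hz₂H
    by_contra hc
    have hz₁x : z₁ ∉ Submodule.span ℝ {x} := hspx z₁ hz₁ (by rintro rfl; exact hz₁H hxH)
    set G := Submodule.span ℝ {x, z₁} ⊔ Submodule.span ℝ {z₂} with hG
    have hG3 : Module.finrank ℝ G ≤ 3 := by
      have h1 := Submodule.finrank_add_le_finrank_add_finrank (Submodule.span ℝ {x, z₁})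
        (Submodule.span ℝ {z₂})
      have h2 := finrank_span_singleton (K := ℝ) (h.1 z₂ hz₂).1
      have h3 := finrank_span_pair_le x z₁
      rw [← hG] at h1
      omega
    have hxG : x ∈ G := Submodule.mem_sup_left (hxx z₁)
    have hz₁G : z₁ ∈ G := Submodule.mem_sup_left (hzz z₁)
    have hz₂G : z₂ ∈ G := Submodule.mem_sup_right (Submodule.mem_span_singleton_self _)
    have hL1G : Submodule.span ℝ {x, z₁} ≤ G := span_pair_le hxG hz₁G
    have hL2G : Submodule.span ℝ {x, z₂} ≤ G := span_pair_le hxG hz₂G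
    obtain ⟨y, hy, hyH, hyG⟩ : ∃ y ∈ X, y ∈ H ∧ y ∉ G := by
      obtain ⟨z₃, hz₃, hz₃G⟩ := hnotle G hG3
      by_cases hz₃H : z₃ ∈ H
      · exact ⟨z₃, hz₃, hz₃H, hz₃G⟩
      set F := Submodule.span ℝ {x, z₁} ⊔ Submodule.span ℝ {z₃} with hF
      have hxF : x ∈ F := Submodule.mem_sup_left (hxx z₁)
      have hev := even_flat h hD hx hz₁ hz₃ hz₁x (fun hm => hz₃G (hL1G hm)) hxF
        (Submodule.mem_sup_left (hzz z₁) : z₁ ∈ F)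
        (Submodule.mem_sup_right (Submodule.mem_span_singleton_self _))
      have hpf := hP F hxF
      by_contra! hcon
      have h2 : (X.filter (· ∈ F)).filter (· ∈ H) = {x} := by
        ext u
        simp only [Finset.mem_filter, Finset.mem_singleton]
        constructor
        · rintro ⟨⟨a, b⟩, c⟩
          have huG := hcon u a c
          obtain ⟨v, hv, w, hw, rfl⟩ := Submodule.mem_sup.1 b
          obtain ⟨r, rfl⟩ := Submodule.mem_span_singleton.1 hw
          by_cases hr : r = 0
          · subst hr
            rw [zero_smul, add_zero] at *
            obtain ⟨p, q, rfl⟩ := Submodule.mem_span_pair.1 hv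
            by_cases hq : q = 0
            · subst hq
              refine h.2 x hx _ a ?_
              simpa using Submodule.smul_mem _ p (Submodule.mem_span_singleton_self x)
            · exact absurd (mem_of_smul_add hq (H.smul_mem p hxH) c) hz₁H
          · exact absurd (mem_of_smul_add hr (hL1G hv) huG) hz₃G
        · rintro rfl; exact ⟨⟨hx, hxF⟩, hxH⟩
      rw [h2, Finset.sum_singleton] at hpf
      omega
    obtain ⟨φ, c1, c2, c3, c4, c5⟩ := cross h hx hz₁ hz₂ hz₁x hc (hL z₁ hz₁ hz₁H) (hL z₂ hz₂ hz₂H)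
    obtain ⟨θ, t1, t2⟩ := pres hyG (-(φ y))
    obtain ⟨ψ, p1, p2⟩ := exact_fun X (Submodule.span ℝ {y})
    obtain ⟨ε, -, hl⟩ := lex X (φ + θ) ψ
    have hy0 : (φ + θ + ε • ψ) y = 0 := by
      simp [t2, p1 y (Submodule.mem_span_singleton_self y)]
    have hne : ∀ u ∈ X, u ≠ y → (φ + θ + ε • ψ) u ≠ 0 := by
      intro u hu huy h0
      have := hl u hu
      rw [h0, sg_zero] at this
      split_ifs at this with hp
      · exact p2 u hu (fun hm => huy (h.2 y hy u hu hm)) (sg_eq_zero this.symm)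
      · exact hp (sg_eq_zero this.symm)
    obtain ⟨φ₁, φ₂, w1, -, -, w4⟩ := wall (W := W) (X := X.filter (· ∈ H)) X
      (Finset.mem_filter.2 ⟨hy, hyH⟩) (h.1 y hy).1 hy0
      (fun u hu => hne u (Finset.mem_filter.1 hu).1)
    have hGs : ∀ u ∈ X, u ∈ G → φ u ≠ 0 → sg ((φ + θ + ε • ψ) u) = sg (φ u) := by
      intro u hu huG h0
      have e : (φ + θ) u = φ u := by simp [t1 u huG]
      rw [hl u hu, e, if_neg h0]
    have hyne : ∀ u, u ∈ G → u ≠ y := by rintro u hu rfl; exact hyG hu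
    have fin : ∀ φ' : E →ₗ[ℝ] ℝ, (∀ u ∈ X, (φ + θ + ε • ψ) u ≠ 0 →
        sg (φ' u) = sg ((φ + θ + ε • ψ) u)) → dd (X.filter (· ∈ H)) W φ' = -2 := by
      intro φ' hs
      have hs' : ∀ u ∈ X, u ∈ G → φ u ≠ 0 → sg (φ' u) = sg (φ u) := fun u hu huG h0 => by
        rw [hs u hu (hne u hu (hyne u huG)), hGs u hu huG h0]
      have d1 : dd (X.filter (· ∈ Submodule.span ℝ {x, z₁})) W φ' = 1 := by
        rw [← c2]
        refine dd_congr fun u hu => ?_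
        have := Finset.mem_filter.1 hu
        exact hs' u this.1 (hL1G this.2) (c4 u hu)
      have d2 : dd (X.filter (· ∈ Submodule.span ℝ {x, z₂})) W φ' = 1 := by
        rw [← c3]
        refine dd_congr fun u hu => ?_
        have := Finset.mem_filter.1 hu
        exact hs' u this.1 (hL2G this.2) (c5 u hu)
      have d3 : W x * sg (φ' x) = -1 := by
        rw [hs' x hx hxG (c4 x (Finset.mem_filter.2 ⟨hx, hxx z₁⟩))]
        exact sg_W hWx c1
      have := sum_lines h hx H hxH φ' d3 (fun z hz hzH => (abs_le.1 (hL z hz hzH φ')).1)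
        hz₁ hz₂ hz₁H hz₂H (fun he => hc (he ▸ hzz z₂)) d1 d2
      have b1 := abs_le.1 (hD φ')
      have b2 := abs_le.1 (restrict_bound hD H φ')
      omega
    rw [fin φ₁ (fun u hu h0 => (w4 u hu h0).1), fin φ₂ (fun u hu h0 => (w4 u hu h0).2)] at w1
    exact (h.1 y hy).2 (by omega)
  · intro z hz hzx
    refine ⟨hLodd z hz, fun ho hzH => ?_⟩
    have hLH : Submodule.span ℝ {x, z} ≤ H := span_pair_le hxH hzH
    set F := Submodule.span ℝ {x, z} ⊔ Submodule.span ℝ {z₀} with hF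
    have hxF : x ∈ F := Submodule.mem_sup_left (hxx z)
    have hev := even_flat h hD hx hz hz₀ (hspx z hz hzx) (fun hm => hz₀H (hLH hm)) hxF
        (Submodule.mem_sup_left (hzz z) : z ∈ F)
        (Submodule.mem_sup_right (Submodule.mem_span_singleton_self _))
    have hpf := hP F hxF
    have h2 : (X.filter (· ∈ F)).filter (· ∈ H) = X.filter (· ∈ Submodule.span ℝ {x, z}) := by
      ext u
      simp only [Finset.mem_filter]
      constructor
      · rintro ⟨⟨a, b⟩, c⟩
        obtain ⟨v, hv, w, hw, rfl⟩ := Submodule.mem_sup.1 b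
        obtain ⟨r, rfl⟩ := Submodule.mem_span_singleton.1 hw
        by_cases hr : r = 0
        · subst hr
          exact ⟨a, by simpa using hv⟩
        · exact absurd (mem_of_smul_add hr (hLH hv) c) hz₀H
      · rintro ⟨a, b⟩
        exact ⟨⟨a, Submodule.mem_sup_left b⟩, hLH b⟩
    rw [h2] at hpf
    omega

/-- Structure of configurations of discrepancy two and rank at least four. -/
lemma disc_two [FiniteDimensional ℝ E] {X : Finset E} {W : E → ℤ} (h : Red X W)
    (hD : ∀ φ, |dd X W φ| ≤ 2) (hrk : 4 ≤ Module.finrank ℝ (Submodule.span ℝ (X : Set E))) :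
    ∃ L K : Submodule ℝ E, Module.finrank ℝ L ≤ 2 ∧ Module.finrank ℝ K ≤ 2 ∧
      ∀ u ∈ X, u ∈ L ∨ u ∈ K := by
  obtain ⟨x, hx, hodd⟩ : ∃ x ∈ X, ¬ (2 : ℤ) ∣ W x := by
    by_contra! hc
    have e : ∀ φ, dd X W φ = 2 * dd X (fun u => W u / 2) φ := by
      intro φ
      unfold dd
      rw [Finset.mul_sum]
      refine Finset.sum_congr rfl fun u hu => ?_
      rw [← mul_assoc, Int.mul_ediv_cancel' (hc u hu)]
    have := disc_one (X := X) (W := fun u => W u / 2) ⟨fun u hu => ⟨(h.1 u hu).1, fun h0 => by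
      have h1 := hc u hu
      have h2 := (h.1 u hu).2
      have h0' : W u / 2 = 0 := h0
      omega⟩, h.2⟩ (fun φ => by
        have h1 := hD φ
        rw [e] at h1
        rw [abs_le] at *
        omega)
    omega
  obtain ⟨H, hH3, hxH, ⟨z, hz, hzH⟩, hu, hi⟩ := package h hD hrk hx hodd
  have hzx : z ≠ x := by rintro rfl; exact hzH hxH
  have hLodd := (hi z hz hzx).1 hzH
  have hr := h.mono (Finset.filter_subset (· ∈ Submodule.span ℝ {x, z}) X)
  have hWz : ¬ (2 : ℤ) ∣ W z := by
    have h1 := weight_bound hr (odd_bound hr (fun φ => restrict_bound hD _ φ) hLodd)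
      (Finset.mem_filter.2 ⟨hz, Submodule.subset_span (by simp)⟩)
    have h2 := (h.1 z hz).2
    rw [abs_le] at h1
    omega
  obtain ⟨H', hH3', hzH', -, hu', hi'⟩ := package h hD hrk hz hWz
  have hxH' : x ∉ H' := by
    rw [hi' x hx hzx.symm, Set.pair_comm]
    exact hLodd
  refine ⟨Submodule.span ℝ {x, z}, H ⊓ H', finrank_span_pair_le _ _, ?_, ?_⟩
  · have hlt : H ⊓ H' < H :=
      SetLike.lt_iff_le_and_exists.2 ⟨inf_le_left, x, hxH, fun hm => hxH' hm.2⟩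
    have := Submodule.finrank_lt_finrank_of_lt hlt
    omega
  · intro u huX
    by_cases h1 : u ∈ H
    · by_cases h2 : u ∈ H'
      · exact Or.inr ⟨h1, h2⟩
      · left
        rw [Set.pair_comm]
        exact hu' x hx hxH' u huX h2
    · exact Or.inl (hu z hz hzH u huX h1)

/-- Number of indices in `S` on which the functional is nonpositive. -/
def npc (V : ι → E) (S : Finset ι) (φ : E →ₗ[ℝ] ℝ) : ℕ := (S.filter fun i => φ (V i) ≤ 0).card

/-- Signed count over a finite set of indices. -/
def ds (V : ι → E) (S : Finset ι) (φ : E →ₗ[ℝ] ℝ) : ℤ := ∑ i ∈ S, sg (φ (V i))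

/-- Dual codegree of a subfamily. -/
def cg (V : ι → E) (S : Finset ι) : ℕ := codegStar (subfam V S)

/-- Rank of a subfamily. -/
def rk (V : ι → E) (S : Finset ι) : ℕ := Module.finrank ℝ (Submodule.span ℝ (V '' (S : Set ι)))

lemma npc_eq (V : ι → E) (S : Finset ι) (φ : E →ₗ[ℝ] ℝ) :
    nonposCount φ (subfam V S) = npc V S φ := by
  unfold nonposCount npc
  refine Finset.card_bij (fun i _ => i.1) ?_ ?_ ?_
  · intro i hi
    exact Finset.mem_filter.2 ⟨i.2, (Finset.mem_filter.1 hi).2⟩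
  · intro i _ j _ h
    exact Subtype.ext h
  · intro i hi
    simp only [Finset.mem_filter] at hi
    exact ⟨⟨i, hi.1⟩, Finset.mem_filter.2 ⟨Finset.mem_univ _, hi.2⟩, rfl⟩

lemma cg_univ (hE : Nontrivial E) (V : ι → E) : codegStar V = cg V Finset.univ := by
  unfold cg codegStar
  simp only [if_pos hE, npc_eq]
  rfl

lemma cg_le (hE : Nontrivial E) (V : ι → E) (S : Finset ι) {φ : E →ₗ[ℝ] ℝ} (h : φ ≠ 0) :
    cg V S ≤ npc V S φ := by
  unfold cg codegStar
  rw [if_pos hE]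
  exact Nat.sInf_le ⟨φ, h, npc_eq V S φ⟩

lemma exists_fun_ne (hE : Nontrivial E) : ∃ φ : E →ₗ[ℝ] ℝ, φ ≠ 0 := by
  obtain ⟨x, hx⟩ := exists_ne (0 : E)
  obtain ⟨θ, -, h⟩ := pres (F := ⊥) (u := x) (by simpa using hx) 1
  exact ⟨θ, fun h0 => by simp [h0] at h⟩

lemma cg_attain (hE : Nontrivial E) (V : ι → E) (S : Finset ι) :
    ∃ φ : E →ₗ[ℝ] ℝ, φ ≠ 0 ∧ npc V S φ = cg V S := by
  obtain ⟨φ0, h0⟩ := exists_fun_ne hE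
  unfold cg codegStar
  rw [if_pos hE]
  obtain ⟨φ, h1, h2⟩ := Nat.sInf_mem (s := {k | ∃ φ : E →ₗ[ℝ] ℝ, φ ≠ 0 ∧
    nonposCount φ (subfam V S) = k}) ⟨_, φ0, h0, rfl⟩
  exact ⟨φ, h1, by rw [← h2, npc_eq]⟩

lemma sg_sum (V : ι → E) (φ : E →ₗ[ℝ] ℝ) :
    (posCount φ V : ℤ) - negCount φ V = ds V Finset.univ φ := by
  unfold posCount negCount ds
  rw [Finset.card_filter, Finset.card_filter]
  push_cast
  rw [← Finset.sum_sub_distrib]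
  refine Finset.sum_congr rfl fun i _ => ?_
  rcases lt_trichotomy (φ (V i)) 0 with h | h | h
  · rw [sg_neg' h, if_neg (by linarith), if_pos h]; rfl
  · simp [h, sg_zero]
  · rw [sg_pos h, if_neg (not_lt.2 h.le), if_pos h]; rfl

lemma ds_le_disc (V : ι → E) (φ : E →ₗ[ℝ] ℝ) : |ds V Finset.univ φ| ≤ disc V := by
  have : (ds V Finset.univ φ).natAbs ≤ disc V := by
    unfold disc
    refine le_csSup ⟨Fintype.card ι, ?_⟩ ⟨φ, by rw [sg_sum]⟩
    rintro k ⟨ψ, rfl⟩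
    have h1 : posCount ψ V ≤ Fintype.card ι := Finset.card_le_univ _
    have h2 : negCount ψ V ≤ Fintype.card ι := Finset.card_le_univ _
    omega
  rw [Int.abs_eq_natAbs]
  exact_mod_cast this

lemma npc_union (V : ι → E) {A B : Finset ι} (h : Disjoint A B) (φ : E →ₗ[ℝ] ℝ) :
    npc V (A ∪ B) φ = npc V A φ + npc V B φ := by
  unfold npc
  rw [Finset.filter_union, Finset.card_union_of_disjoint (Finset.disjoint_filter_filter h)]

lemma ds_union (V : ι → E) {A B : Finset ι} (h : Disjoint A B) (φ : E →ₗ[ℝ] ℝ) :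
    ds V (A ∪ B) φ = ds V A φ + ds V B φ := Finset.sum_union h

lemma cg_add (hE : Nontrivial E) (V : ι → E) {A B : Finset ι} (h : Disjoint A B)
    {φ : E →ₗ[ℝ] ℝ} (h0 : φ ≠ 0) (hA : npc V A φ ≤ cg V A) (hB : npc V B φ ≤ cg V B) :
    cg V (A ∪ B) = cg V A + cg V B := by
  apply le_antisymm
  · have := cg_le hE V (A ∪ B) h0
    rw [npc_union V h] at this
    omega
  · obtain ⟨ψ, h1, h2⟩ := cg_attain hE V (A ∪ B)
    have := cg_le hE V A h1
    have := cg_le hE V B h1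
    rw [npc_union V h] at h2
    omega

lemma npc_congr (V : ι → E) {A : Finset ι} {φ ψ : E →ₗ[ℝ] ℝ}
    (h : ∀ i ∈ A, φ (V i) = ψ (V i)) : npc V A φ = npc V A ψ := by
  unfold npc
  congr 1
  exact Finset.filter_congr fun i hi => by rw [h i hi]

lemma ds_congr (V : ι → E) {A : Finset ι} {φ ψ : E →ₗ[ℝ] ℝ}
    (h : ∀ i ∈ A, φ (V i) = ψ (V i)) : ds V A φ = ds V A ψ :=
  Finset.sum_congr rfl fun i hi => by rw [h i hi]

lemma glue {L K : Submodule ℝ E} (h : Disjoint L K) (φ₁ φ₂ : E →ₗ[ℝ] ℝ) :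
    ∃ φ : E →ₗ[ℝ] ℝ, (∀ v ∈ L, φ v = φ₁ v) ∧ ∀ v ∈ K, φ v = φ₂ v := by
  obtain ⟨L', hL, hc⟩ := h.exists_isCompl
  refine ⟨φ₁ ∘ₗ L'.projection K hc + φ₂ ∘ₗ (LinearMap.id - L'.projection K hc), ?_, ?_⟩
  · intro v hv
    simp [Submodule.projection_apply_of_mem_left hc (hL hv)]
  · intro v hv
    simp [Submodule.projection_apply_of_mem_right hc hv]

lemma ds_pos (V : ι → E) {A : Finset ι} {φ : E →ₗ[ℝ] ℝ} (h : npc V A φ = 0) :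
    ds V A φ = A.card := by
  unfold npc at h
  rw [Finset.card_eq_zero, Finset.filter_eq_empty_iff] at h
  unfold ds
  rw [Finset.sum_congr rfl fun i hi => sg_pos (not_le.1 (h hi))]
  simp

lemma rk_le_card (V : ι → E) (A : Finset ι) : rk V A ≤ A.card := by
  unfold rk
  rw [← Finset.coe_image]
  exact (finrank_span_finset_le_card _).trans Finset.card_image_le

lemma rk_union (V : ι → E) (A B : Finset ι) [FiniteDimensional ℝ E] :
    rk V (A ∪ B) ≤ rk V A + rk V B := by
  unfold rk
  rw [Finset.coe_union, Set.image_union, Submodule.span_union]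
  exact Submodule.finrank_add_le_finrank_add_finrank _ _

lemma rk_le (V : ι → E) {A : Finset ι} [FiniteDimensional ℝ E] {L : Submodule ℝ E}
    (h : ∀ i ∈ A, V i ∈ L) : rk V A ≤ Module.finrank ℝ L := by
  refine Submodule.finrank_mono (Submodule.span_le.2 ?_)
  rintro _ ⟨i, hi, rfl⟩
  exact h i hi

/-- Crossing the wall orthogonal to `V i`. -/
lemma wallfam (V : ι → E) {B : Finset ι} (h0 : ∀ i, V i ≠ 0)
    (hB : ∀ i ∈ B, ∀ j ∈ B, ∀ c : ℝ, 0 < c → V j ≠ -(c • V i)) {i : ι} (hi : i ∈ B)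
    (Y : Finset E) : ∃ ψ φ : E →ₗ[ℝ] ℝ, ds V B ψ < ds V B φ ∧
      ∀ u ∈ Y, u ∉ Submodule.span ℝ {V i} → sg (φ u) = sg (ψ u) := by
  obtain ⟨ψ, h1, h2⟩ := exact_fun (Y ∪ B.image V) (Submodule.span ℝ {V i})
  obtain ⟨χ, -, h3⟩ := pres (F := ⊥) (u := V i) (by simpa using h0 i) 1
  obtain ⟨ε, hε, h4⟩ := lex (Y ∪ B.image V) ψ χ
  refine ⟨ψ, ψ + ε • χ, ?_, ?_⟩
  · refine Finset.sum_lt_sum ?_ ⟨i, hi, ?_⟩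
    · intro j hj
      rw [h4 (V j) (Finset.mem_union_right _ (Finset.mem_image_of_mem V hj))]
      split_ifs with h
      · rw [h, sg_zero]
        by_contra hneg
        have hm : V j ∈ Submodule.span ℝ {V i} := by
          by_contra hm
          exact h2 _ (Finset.mem_union_right _ (Finset.mem_image_of_mem V hj)) hm h
        obtain ⟨c, hc⟩ := Submodule.mem_span_singleton.1 hm
        have hc0 : c < 0 := by
          by_contra hcn
          rcases (not_lt.1 hcn).eq_or_lt with h | h
          · rw [← h, zero_smul] at hc
            exact h0 j hc.symm
          · rw [← hc, map_smul, h3, smul_eq_mul, mul_one, sg_pos h] at hneg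
            omega
        refine hB i hi j hj (-c) (by linarith) ?_
        rw [neg_smul, neg_neg, hc]
      · exact le_rfl
    · have hz : ψ (V i) = 0 := h1 _ (Submodule.mem_span_singleton_self _)
      rw [h4 (V i) (Finset.mem_union_right _ (Finset.mem_image_of_mem V hi)), if_pos hz, hz, h3,
        sg_zero, sg_pos one_pos]
      norm_num
  · intro u hu hn
    rw [h4 u (Finset.mem_union_left _ hu), if_neg (h2 u (Finset.mem_union_left _ hu) hn)]

lemma ds_neg (V : ι → E) (B : Finset ι) (φ : E →ₗ[ℝ] ℝ) : ds V B (-φ) = - ds V B φ := by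
  simp [ds, sg_neg]

lemma exists_ds_pos (V : ι → E) {B : Finset ι} (h0 : ∀ i, V i ≠ 0)
    (hB : ∀ i ∈ B, ∀ j ∈ B, ∀ c : ℝ, 0 < c → V j ≠ -(c • V i)) {i : ι} (hi : i ∈ B) :
    ∃ θ : E →ₗ[ℝ] ℝ, 1 ≤ ds V B θ := by
  obtain ⟨ψ, φ, h, -⟩ := wallfam V h0 hB hi ∅
  by_cases h1 : 1 ≤ ds V B φ
  · exact ⟨φ, h1⟩
  · refine ⟨-ψ, ?_⟩
    rw [ds_neg]
    omega

/-- A collection of disjoint parts of `S` realizing its dual codegree. -/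
def Good (V : ι → E) (S : Finset ι) (D : ℕ) : Prop :=
  ∃ P : Finset (Finset ι), (∀ p ∈ P, p ⊆ S) ∧ (∀ p ∈ P, ∀ q ∈ P, p ≠ q → Disjoint p q) ∧
    (∀ p ∈ P, 1 ≤ cg V p) ∧ cg V S = ∑ p ∈ P, cg V p ∧ rk V S ≤ P.card + D

lemma pair_step (hE : Nontrivial E) [FiniteDimensional ℝ E] (V : ι → E) (h0 : ∀ i, V i ≠ 0)
    {S : Finset ι} {D : ℕ} {i j : ι} (hi : i ∈ S) (hj : j ∈ S) {c : ℝ} (hc : 0 < c)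
    (hij : V j = -(c • V i)) (hG : Good V (S \ {i, j}) D) : Good V S D := by
  have hne : i ≠ j := by
    rintro rfl
    have h1 : (1 + c) • V i = 0 := by
      rw [add_smul, one_smul]
      nth_rewrite 1 [hij]
      simp
    rcases smul_eq_zero.1 h1 with h | h
    · linarith
    · exact h0 i h
  have hsub : ({i, j} : Finset ι) ⊆ S := by
    intro k hk
    rcases Finset.mem_insert.1 hk with rfl | hk
    · exact hi
    · rw [Finset.mem_singleton.1 hk]; exact hj
  have hval : ∀ φ : E →ₗ[ℝ] ℝ, φ (V j) = -(c * φ (V i)) := fun φ => by rw [hij]; simp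
  have hnp : ∀ φ : E →ₗ[ℝ] ℝ, npc V {i, j} φ =
      (if φ (V i) ≤ 0 then 1 else 0) + (if φ (V j) ≤ 0 then 1 else 0) := fun φ => by
    unfold npc
    rw [Finset.card_filter, Finset.sum_pair hne]
  have hge : ∀ φ : E →ₗ[ℝ] ℝ, 1 ≤ npc V {i, j} φ := fun φ => by
    rw [hnp]
    by_cases h : φ (V i) ≤ 0
    · rw [if_pos h]; omega
    · rw [if_pos (show φ (V j) ≤ 0 by rw [hval]; nlinarith)]; omega
  have heq : ∀ φ : E →ₗ[ℝ] ℝ, φ (V i) ≠ 0 → npc V {i, j} φ = 1 := fun φ hφ => by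
    rw [hnp]
    rcases lt_or_gt_of_ne hφ with h | h
    · rw [if_pos h.le, if_neg]
      rw [hval]; nlinarith
    · rw [if_neg (by linarith), if_pos]
      rw [hval]; nlinarith
  have hcg1 : 1 ≤ cg V {i, j} := by
    obtain ⟨ψ, -, h2⟩ := cg_attain hE V {i, j}
    rw [← h2]; exact hge ψ
  have hdisj : Disjoint (S \ {i, j}) ({i, j} : Finset ι) := Finset.sdiff_disjoint
  have hun : (S \ {i, j}) ∪ {i, j} = S := Finset.sdiff_union_of_subset hsub
  have hadd : cg V S = cg V (S \ {i, j}) + cg V {i, j} := by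
    obtain ⟨ψ, -, h2⟩ := cg_attain hE V (S \ {i, j})
    obtain ⟨χ, -, h3⟩ := pres (F := ⊥) (u := V i) (by simpa using h0 i) 1
    obtain ⟨ε, hε, h4⟩ := lex (S.image V) ψ χ
    have hφi : (ψ + ε • χ) (V i) ≠ 0 := by
      intro hz
      have := h4 (V i) (Finset.mem_image_of_mem V hi)
      rw [hz, sg_zero] at this
      split_ifs at this with h
      · rw [h3, sg_pos one_pos] at this; omega
      · exact h (sg_eq_zero this.symm)
    conv_lhs => rw [← hun]
    refine cg_add hE V hdisj (φ := ψ + ε • χ) (fun h => hφi (by rw [h]; rfl)) ?_ ?_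
    · rw [← h2]
      refine Finset.card_le_card fun k hk => ?_
      rw [Finset.mem_filter] at hk ⊢
      refine ⟨hk.1, ?_⟩
      by_contra hn
      have := h4 (V k) (Finset.mem_image_of_mem V (Finset.mem_sdiff.1 hk.1).1)
      rw [if_neg (by linarith), sg_pos (not_le.1 hn)] at this
      rcases hk.2.lt_or_eq with h | h
      · rw [sg_neg' h] at this; omega
      · rw [h, sg_zero] at this; omega
    · rw [heq _ hφi]; exact hcg1
  obtain ⟨P, p1, p2, p3, p4, p5⟩ := hG
  have hnot : ({i, j} : Finset ι) ∉ P := by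
    intro hp
    have := p1 _ hp (Finset.mem_insert_self i {j})
    simp at this
  refine ⟨insert {i, j} P, ?_, ?_, ?_, ?_, ?_⟩
  · intro p hp
    rcases Finset.mem_insert.1 hp with rfl | hp
    · exact hsub
    · exact (p1 p hp).trans Finset.sdiff_subset
  · intro p hp q hq hpq
    rcases Finset.mem_insert.1 hp with rfl | hp <;> rcases Finset.mem_insert.1 hq with rfl | hq
    · exact absurd rfl hpq
    · exact (hdisj.mono_left (p1 q hq)).symm
    · exact hdisj.mono_left (p1 p hp)
    · exact p2 p hp q hq hpq
  · intro p hp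
    rcases Finset.mem_insert.1 hp with rfl | hp
    · exact hcg1
    · exact p3 p hp
  · rw [Finset.sum_insert hnot, hadd, p4, add_comm]
  · rw [Finset.card_insert_of_notMem hnot]
    have h1 := rk_union V (S \ {i, j}) {i, j}
    rw [hun] at h1
    have h2 : rk V {i, j} ≤ 1 := by
      refine (rk_le V (L := Submodule.span ℝ {V i}) ?_).trans (finrank_span_singleton (h0 i)).le
      intro k hk
      rcases Finset.mem_insert.1 hk with rfl | hk
      · exact Submodule.mem_span_singleton_self _
      · rw [Finset.mem_singleton.1 hk, hij]
        exact Submodule.neg_mem _ (Submodule.smul_mem _ _ (Submodule.mem_span_singleton_self _))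
    omega

/-- The positive codegree of one part of a splitting of discrepancy at most two. -/
lemma part_pos (hE : Nontrivial E) (V : ι → E) (h0 : ∀ i, V i ≠ 0) {A B : Finset ι}
    (hB : ∀ i ∈ B, ∀ j ∈ B, ∀ c : ℝ, 0 < c → V j ≠ -(c • V i)) (hd : Disjoint A B)
    (hds : ∀ φ : E →ₗ[ℝ] ℝ, |ds V (A ∪ B) φ| ≤ 2) {L K : Submodule ℝ E} (hLK : Disjoint L K)
    (hAL : ∀ i ∈ A, V i ∈ L) (hBK : ∀ i ∈ B, V i ∈ K) (hA2 : 2 ≤ A.card) (hB1 : B.Nonempty) :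
    1 ≤ cg V A := by
  by_contra hc
  obtain ⟨φ, -, h2⟩ := cg_attain hE V A
  have h3 := ds_pos V (show npc V A φ = 0 by omega)
  obtain ⟨i, hi⟩ := hB1
  obtain ⟨θ, h4⟩ := exists_ds_pos V h0 hB hi
  obtain ⟨ρ, h5, h6⟩ := glue hLK φ θ
  have h7 := hds ρ
  rw [ds_union V hd, ds_congr V (fun i hi => h5 _ (hAL i hi)),
    ds_congr V (fun i hi => h6 _ (hBK i hi)), abs_le] at h7
  omega

lemma base_case (hE : Nontrivial E) [FiniteDimensional ℝ E] (V : ι → E) (h0 : ∀ i, V i ≠ 0)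
    {S : Finset ι} {D : ℕ} (hD2 : D ≤ 2) (hD : ∀ φ : E →ₗ[ℝ] ℝ, |ds V S φ| ≤ D)
    (hS : ∀ i ∈ S, ∀ j ∈ S, ∀ c : ℝ, 0 < c → V j ≠ -(c • V i)) : Good V S D := by
  by_cases hc0 : cg V S = 0
  · refine ⟨∅, by simp, by simp, by simp, by simp [hc0], ?_⟩
    obtain ⟨φ, -, h2⟩ := cg_attain hE V S
    have h3 := ds_pos V (h2.trans hc0)
    have h4 := hD φ
    have h5 := rk_le_card V S
    rw [abs_le] at h4
    simp only [Finset.card_empty]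
    omega
  by_cases hr : rk V S ≤ D + 1
  · refine ⟨{S}, ?_, ?_, ?_, ?_, ?_⟩
    · intro p hp; rw [Finset.mem_singleton.1 hp]
    · intro p hp q hq hpq
      rw [Finset.mem_singleton.1 hp, Finset.mem_singleton.1 hq] at hpq
      exact absurd rfl hpq
    · intro p hp; rw [Finset.mem_singleton.1 hp]; omega
    · simp
    · simp only [Finset.card_singleton]; omega
  obtain ⟨X, W, hR, hdd⟩ := reduce_family S V (fun _ => 1)
  have hdd' : ∀ φ : E →ₗ[ℝ] ℝ, dd X W φ = ds V S φ := fun φ => by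
    rw [hdd]; simp [ds]
  have hmem : ∀ i ∈ S, ∃ u ∈ X, V i ∈ Submodule.span ℝ {u} := by
    intro i hi
    by_contra! hcon
    obtain ⟨ψ, φ, h1, h2⟩ := wallfam V h0 hS hi X
    rw [← hdd', ← hdd'] at h1
    refine h1.ne' (dd_congr fun u hu => h2 u hu fun hm => hcon u hu ?_)
    obtain ⟨a, ha⟩ := Submodule.mem_span_singleton.1 hm
    have ha0 : a ≠ 0 := by
      rintro rfl
      rw [zero_smul] at ha
      exact (hR.1 u hu).1 ha.symm
    refine Submodule.mem_span_singleton.2 ⟨a⁻¹, ?_⟩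
    rw [← ha, smul_smul, inv_mul_cancel₀ ha0, one_smul]
  have hrX : rk V S ≤ Module.finrank ℝ (Submodule.span ℝ (X : Set E)) := by
    refine rk_le V fun i hi => ?_
    obtain ⟨u, hu, hm⟩ := hmem i hi
    exact Submodule.span_mono (by simpa using hu) hm
  have hbd : ∀ φ : E →ₗ[ℝ] ℝ, |dd X W φ| ≤ D := fun φ => by rw [hdd']; exact hD φ
  interval_cases D
  · exfalso
    have hX : X.Nonempty := by
      rw [Finset.nonempty_iff_ne_empty]
      intro hX
      rw [hX, Finset.coe_empty, Submodule.span_empty, finrank_bot] at hrX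
      omega
    obtain ⟨x, hx⟩ := hX
    obtain ⟨χ, hχ⟩ := nonvanish hR hx
    have := hbd χ
    rw [abs_le] at this
    omega
  · have := disc_one hR (by simpa using hbd)
    omega
  · obtain ⟨L, K, hL, hK, hLK⟩ := disc_two hR (by simpa using hbd) (by omega)
    have hVLK : ∀ i ∈ S, V i ∈ L ∨ V i ∈ K := by
      intro i hi
      obtain ⟨u, hu, hm⟩ := hmem i hi
      rcases hLK u hu with h | h
      · exact Or.inl ((Submodule.span_singleton_le_iff_mem u L).2 h hm)
      · exact Or.inr ((Submodule.span_singleton_le_iff_mem u K).2 h hm)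
    have hsup : rk V S ≤ Module.finrank ℝ (L ⊔ K : Submodule ℝ E) := by
      refine rk_le V fun i hi => ?_
      rcases hVLK i hi with h | h
      · exact Submodule.mem_sup_left h
      · exact Submodule.mem_sup_right h
    have hfr := Submodule.finrank_sup_add_finrank_inf_eq L K
    have hdis : Disjoint L K := by
      rw [disjoint_iff]
      exact Submodule.finrank_eq_zero.1 (by omega)
    set A := S.filter fun i => V i ∈ L with hA
    set B := S.filter fun i => ¬ V i ∈ L with hB
    have hAB : Disjoint A B := Finset.disjoint_filter_filter_not _ _ _
    have hun : A ∪ B = S := Finset.filter_union_filter_not_eq _ _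
    have hAS : A ⊆ S := Finset.filter_subset _ _
    have hBS : B ⊆ S := Finset.filter_subset _ _
    have hAL : ∀ i ∈ A, V i ∈ L := fun i hi => (Finset.mem_filter.1 hi).2
    have hBK : ∀ i ∈ B, V i ∈ K := fun i hi =>
      (hVLK i (hBS hi)).resolve_left (Finset.mem_filter.1 hi).2
    have hrA := rk_le V hAL
    have hrB := rk_le V hBK
    have hru := rk_union V A B
    rw [hun] at hru
    have hcA := rk_le_card V A
    have hcB := rk_le_card V B
    have hAne : A.Nonempty := Finset.card_pos.1 (by omega)
    have hBne : B.Nonempty := Finset.card_pos.1 (by omega)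
    have gA : 1 ≤ cg V A := part_pos hE V h0 (fun i hi j hj => hS i (hBS hi) j (hBS hj)) hAB
      (fun φ => by rw [hun]; simpa using hD φ) hdis hAL hBK (by omega) hBne
    have gB : 1 ≤ cg V B := part_pos hE V h0 (fun i hi j hj => hS i (hAS hi) j (hAS hj)) hAB.symm
      (fun φ => by rw [Finset.union_comm, hun]; simpa using hD φ) hdis.symm hBK hAL (by omega) hAne
    have hne : A ≠ B := by
      intro h
      rw [h, disjoint_self] at hAB
      exact hBne.ne_empty hAB
    have hadd : cg V S = cg V A + cg V B := by
      obtain ⟨φA, -, a2⟩ := cg_attain hE V A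
      obtain ⟨φB, -, b2⟩ := cg_attain hE V B
      obtain ⟨φ, h5, h6⟩ := glue hdis φA φB
      have eA : npc V A φ = cg V A := by rw [← a2]; exact npc_congr V fun i hi => h5 _ (hAL i hi)
      have eB : npc V B φ = cg V B := by rw [← b2]; exact npc_congr V fun i hi => h6 _ (hBK i hi)
      conv_lhs => rw [← hun]
      by_cases hφ : φ = 0
      · obtain ⟨χ, hχ⟩ := exists_fun_ne hE
        have hle : ∀ T : Finset ι, npc V T χ ≤ npc V T (0 : E →ₗ[ℝ] ℝ) := fun T => by
          unfold npc
          simpa using Finset.card_filter_le T _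
        rw [hφ] at eA eB
        exact cg_add hE V hAB hχ ((hle A).trans eA.le) ((hle B).trans eB.le)
      · exact cg_add hE V hAB hφ eA.le eB.le
    refine ⟨{A, B}, ?_, ?_, ?_, ?_, ?_⟩
    · intro p hp
      rcases Finset.mem_insert.1 hp with rfl | hp
      · exact hAS
      · rw [Finset.mem_singleton.1 hp]; exact hBS
    · intro p hp q hq hpq
      rw [Finset.mem_insert, Finset.mem_singleton] at hp hq
      rcases hp with hp | hp <;> rcases hq with hq | hq <;> rw [hp, hq] at hpq ⊢
      · exact absurd rfl hpq
      · exact hAB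
      · exact hAB.symm
      · exact absurd rfl hpq
    · intro p hp
      rw [Finset.mem_insert, Finset.mem_singleton] at hp
      rcases hp with hp | hp <;> rw [hp]
      · exact gA
      · exact gB
    · rw [Finset.sum_pair hne, hadd]
    · rw [Finset.card_pair hne]; omega

lemma good_all (hE : Nontrivial E) [FiniteDimensional ℝ E] (V : ι → E) (h0 : ∀ i, V i ≠ 0)
    {D : ℕ} (hD2 : D ≤ 2) (S : Finset ι) :
    (∀ φ : E →ₗ[ℝ] ℝ, |ds V S φ| ≤ D) → Good V S D := by
  induction S using Finset.strongInduction with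
  | H S ih =>
    intro hD
    by_cases hS : ∀ i ∈ S, ∀ j ∈ S, ∀ c : ℝ, 0 < c → V j ≠ -(c • V i)
    · exact base_case hE V h0 hD2 hD hS
    · push Not at hS
      obtain ⟨i, hi, j, hj, c, hc, hij⟩ := hS
      have hsub : ({i, j} : Finset ι) ⊆ S := by
        intro k hk
        rcases Finset.mem_insert.1 hk with rfl | hk
        · exact hi
        · rw [Finset.mem_singleton.1 hk]; exact hj
      refine pair_step hE V h0 hi hj hc hij (ih _ ?_ fun φ => ?_)
      · exact Finset.sdiff_ssubset hsub ⟨i, Finset.mem_insert_self _ _⟩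
      · have hne : i ≠ j := by
          rintro rfl
          have h1 : (1 + c) • V i = 0 := by
            rw [add_smul, one_smul]
            nth_rewrite 1 [hij]
            simp
          rcases smul_eq_zero.1 h1 with h | h
          · linarith
          · exact h0 i h
        have h1 := hD φ
        have h2 : ds V {i, j} φ = 0 := by
          unfold ds
          rw [Finset.sum_pair hne, hij, map_neg, map_smul, smul_eq_mul, sg_neg, sg_mul, sg_pos hc]
          ring
        rw [← Finset.sdiff_union_of_subset hsub, ds_union V Finset.sdiff_disjoint, h2, add_zero]
          at h1
        exact h1

/-- an irreducible configuration of rank `r` with `disc V ≤ 2` admits a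
codegree* decomposition of length at least `r − disc V`. -/
theorem codegree_decomposition_of_small_disc {E : Type*} [AddCommGroup E] [Module ℝ E]
    [FiniteDimensional ℝ E] (hE : 1 ≤ Module.finrank ℝ E)
    {ι : Type*} [Fintype ι] (V : ι → E) (hirr : ∀ i, V i ≠ 0) (hV : disc V ≤ 2) :
    ∃ (m : ℕ) (S : Fin (m + 1) → Finset ι),
      IsCodegDecomp V m S ∧ (confRank V : ℤ) - (disc V : ℤ) ≤ (m : ℤ) := by
  have hnt : Nontrivial E := Module.nontrivial_of_finrank_pos (R := ℝ) hE
  obtain ⟨P, p1, p2, p3, p4, p5⟩ := good_all hnt V hirr hV Finset.univ (ds_le_disc V)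
  have hrk : confRank V = rk V Finset.univ := by
    unfold confRank rk
    rw [Finset.coe_univ, Set.image_univ]
  let f : Fin P.card → Finset ι := fun k => (P.equivFin.symm k).1
  have hf : ∀ k, f k ∈ P := fun k => (P.equivFin.symm k).2
  have hinj : Function.Injective f := fun a b h => P.equivFin.symm.injective (Subtype.ext h)
  have hsurj : ∀ p ∈ P, ∃ k, f k = p := fun p hp => ⟨P.equivFin ⟨p, hp⟩, by simp [f]⟩
  have hrest : ∀ p ∈ P, Disjoint (Finset.univ \ P.biUnion id) p := fun p hp =>
    Finset.sdiff_disjoint.mono_right (Finset.subset_biUnion_of_mem id hp)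
  refine ⟨P.card, Fin.cons (Finset.univ \ P.biUnion id) f, ⟨?_, ?_, ?_, ?_⟩, ?_⟩
  · intro i j
    refine Fin.cases ?_ (fun a => ?_) i <;> refine Fin.cases ?_ (fun b => ?_) j
    · intro h; exact absurd rfl h
    · intro _; exact hrest _ (hf b)
    · intro _; exact (hrest _ (hf a)).symm
    · intro h
      refine p2 _ (hf a) _ (hf b) fun hab => h ?_
      rw [hinj hab]
  · intro x
    by_cases hx : x ∈ P.biUnion id
    · obtain ⟨p, hp, hxp⟩ := Finset.mem_biUnion.1 hx
      obtain ⟨k, rfl⟩ := hsurj p hp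
      exact ⟨k.succ, hxp⟩
    · exact ⟨0, Finset.mem_sdiff.2 ⟨Finset.mem_univ _, hx⟩⟩
  · intro i
    refine Fin.cases ?_ (fun a => ?_) i
    · intro h; exact absurd rfl h
    · intro _; exact p3 _ (hf a)
  · rw [cg_univ hnt, p4]
    have h1 : ∑ p ∈ P, cg V p = ∑ k, cg V (f k) := by
      rw [← Finset.sum_coe_sort P]
      exact (Equiv.sum_comp P.equivFin.symm (fun p : P => cg V p.1)).symm
    have h2 := Finset.add_sum_erase (Finset.univ : Finset (Fin (P.card + 1)))
      (fun i => cg V ((Fin.cons (Finset.univ \ P.biUnion id) f : Fin (P.card + 1) → Finset ι) i))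
      (Finset.mem_univ 0)
    rw [Fin.sum_univ_succ] at h2
    rw [h1]
    exact (Nat.add_left_cancel h2).symm
  · rw [hrk]; omega

end
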